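/- For every integer m ≥ 1, writing s = n − 2m, one has (2n − 6s)·Ma_m(P) ≤ 24·(s + 2)·Ma_{m−1}(P). -/

import Mathlib

open scoped Classical

noncomputable section

/-- A point of the plane. -/
abbrev Pt : Type := ℝ × ℝ

/-- The closed straight-line segment with endpoints `a` and `b`. -/
def Seg (a b : Pt) : Set Pt := segment ℝ a b

/-- `P` is in general position: no three points of `P` are collinear and
no two points of `P` have the same `x`-coordinate. -/
def GenPos (P : Finset Pt) : Prop :=
  (∀ p ∈ P, ∀ q ∈ P, ∀ r ∈ P, p ≠ q → q ≠ r → p ≠ r →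
      ¬ Collinear ℝ ({p, q, r} : Set Pt)) ∧
  ∀ p ∈ P, ∀ q ∈ P, p ≠ q → p.1 ≠ q.1

/-- `M` is a crossing-free matching of `P`.  Each edge is recorded as an ordered
pair `(left endpoint, right endpoint)`, the left endpoint being the one of
smaller `x`-coordinate.  No point is an endpoint of more than one edge and no
two distinct edges intersect. -/
structure IsMatching (P : Finset Pt) (M : Finset (Pt × Pt)) : Prop where
  left_mem : ∀ e ∈ M, e.1 ∈ P
  right_mem : ∀ e ∈ M, e.2 ∈ P
  x_lt : ∀ e ∈ M, e.1.1 < e.2.1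
  no_shared : ∀ e ∈ M, ∀ f ∈ M, e ≠ f →
      e.1 ≠ f.1 ∧ e.1 ≠ f.2 ∧ e.2 ≠ f.1 ∧ e.2 ≠ f.2
  no_cross : ∀ e ∈ M, ∀ f ∈ M, e ≠ f → Seg e.1 e.2 ∩ Seg f.1 f.2 = ∅

/-- `p` is isolated in `M`: it is an endpoint of no edge of `M`. -/
def Isolated (M : Finset (Pt × Pt)) (p : Pt) : Prop :=
  ∀ e ∈ M, e.1 ≠ p ∧ e.2 ≠ p

/-- The `y`-coordinate of the point of the line through the endpoints of `e`
having abscissa `x`. -/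
def yOn (e : Pt × Pt) (x : ℝ) : ℝ :=
  e.1.2 + (x - e.1.1) * (e.2.2 - e.1.2) / (e.2.1 - e.1.1)

/-- The point of (the line supporting) the edge `e` with the same
`x`-coordinate as `q`. -/
def vproj (e : Pt × Pt) (q : Pt) : Pt := (q.1, yOn e q.1)

/-- `q` is vertically visible from the interior of the edge `e` of `M`:
its `x`-coordinate lies strictly between the `x`-coordinates of the endpoints
of `e`, and the open vertical segment joining `q` to the point of `e` with the
same `x`-coordinate meets no edge of `M` and contains no point of `P`. -/
def VertVisible (P : Finset Pt) (M : Finset (Pt × Pt)) (q : Pt) (e : Pt × Pt) : Prop :=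
  e.1.1 < q.1 ∧ q.1 < e.2.1 ∧
  (∀ f ∈ M, openSegment ℝ q (vproj e q) ∩ Seg f.1 f.2 = ∅) ∧
  ∀ r ∈ P, r ∉ openSegment ℝ q (vproj e q)

/-- `p` is the left endpoint of some edge of `M`. -/
def IsLeftEndpoint (M : Finset (Pt × Pt)) (p : Pt) : Prop := ∃ e ∈ M, e.1 = p

/-- `p` is the right endpoint of some edge of `M`. -/
def IsRightEndpoint (M : Finset (Pt × Pt)) (p : Pt) : Prop := ∃ e ∈ M, e.2 = p

/-- The rank `d_M(p)` of `p` in `M`. -/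
def rank (P : Finset Pt) (M : Finset (Pt × Pt)) (p : Pt) : ℕ :=
  if h : ∃ e ∈ M, e.1 = p then
    (P.filter fun q =>
      (Isolated M q ∨ IsLeftEndpoint M q) ∧ VertVisible P M q h.choose).card
  else if h' : ∃ e ∈ M, e.2 = p then
    (P.filter fun q =>
      (Isolated M q ∨ IsRightEndpoint M q) ∧ VertVisible P M q h'.choose).card
  else 0

/-- The result of inserting the edge `qp` into `M` (oriented left-to-right). -/
def addEdge (M : Finset (Pt × Pt)) (q p : Pt) : Finset (Pt × Pt) :=
  if q.1 < p.1 then insert (q, p) M else insert (p, q) M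

/-- `h_i(p,M)`: the number of points `q ∈ P` such that `M ∪ {qp}` is a
crossing-free matching of `P` in which `p` has rank `i`. -/
def hcount (P : Finset Pt) (M : Finset (Pt × Pt)) (p : Pt) (i : ℕ) : ℕ :=
  (P.filter fun q =>
    IsMatching P (addEdge M q p) ∧ rank P (addEdge M q p) p = i).card

/-- `l_i(p,M)`: the number of points `q ∈ P` to the left of `p` such that
`M ∪ {qp}` is a crossing-free matching of `P` in which `p` has rank `i`. -/
def lcount (P : Finset Pt) (M : Finset (Pt × Pt)) (p : Pt) (i : ℕ) : ℕ :=
  (P.filter fun q => q.1 < p.1 ∧ IsMatching P (insert (q, p) M) ∧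
    rank P (insert (q, p) M) p = i).card

/-- `v_i(M)`: the number of points of `P` of rank `i` in `M`. -/
def vcount (P : Finset Pt) (M : Finset (Pt × Pt)) (i : ℕ) : ℕ :=
  (P.filter fun p => rank P M p = i).card

/-- The (finite) collection of crossing-free matchings of `P` with `m` edges. -/
def Matchings (P : Finset Pt) (m : ℕ) : Finset (Finset (Pt × Pt)) :=
  (P ×ˢ P).powerset.filter fun M => IsMatching P M ∧ M.card = m

/-- `Ma_m(P)`: the number of crossing-free matchings of `P` with `m` edges. -/
def Ma (P : Finset Pt) (m : ℕ) : ℕ := (Matchings P m).card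

/-- `S_k(m)`: the sum of `Σ_{i=0}^{k} (k-i) h_i(p,M')` over all pairs `(p, M')`
with `M'` a crossing-free matching of `P` with `m-1` edges and `p ∈ P`
isolated in `M'`. -/
def Ssum (P : Finset Pt) (k m : ℕ) : ℕ :=
  ∑ M ∈ Matchings P (m - 1), ∑ p ∈ P.filter (fun p => Isolated M p),
    ∑ i ∈ Finset.range (k + 1), (k - i) * hcount P M p i

/-- The union of the edges of `M`, as a subset of the plane. -/
def edgesSet (M : Finset (Pt × Pt)) : Set Pt := ⋃ e ∈ M, Seg e.1 e.2

/-- The vertical wall of `r`: the maximal open vertical segment through `r`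
meeting no edge of `M` except possibly at `r` itself. -/
def Wall (M : Finset (Pt × Pt)) (r : Pt) : Set Pt :=
  {x : Pt | x.1 = r.1 ∧
    ∀ z : Pt, z.1 = r.1 → z.2 ∈ Set.uIcc x.2 r.2 → z ≠ r → z ∉ edgesSet M}

/-- The complement of the union of all edges of `M` and all vertical walls of
points of `P`; its connected components are the cells of the vertical
decomposition. -/
def FreeRegion (P : Finset Pt) (M : Finset (Pt × Pt)) : Set Pt :=
  (edgesSet M ∪ ⋃ r ∈ P, Wall M r)ᶜ

/-- `T` is a cell of the vertical decomposition of `M`. -/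
def IsCell (P : Finset Pt) (M : Finset (Pt × Pt)) (T : Set Pt) : Prop :=
  ∃ x ∈ FreeRegion P M, T = connectedComponentIn (FreeRegion P M) x

/-- `T` is the cell containing the points `(x(p) - ε, y(p))` for all
sufficiently small `ε > 0`. -/
def IsLeftCellOf (P : Finset Pt) (M : Finset (Pt × Pt)) (p : Pt) (T : Set Pt) : Prop :=
  IsCell P M T ∧ ∃ ε₀ > (0 : ℝ), ∀ ε : ℝ, 0 < ε → ε < ε₀ →
    ((p.1 - ε, p.2) : Pt) ∈ T

/-- `T` is the cell containing the points `(x(p) + ε, y(p))` for all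
sufficiently small `ε > 0`. -/
def IsRightCellOf (P : Finset Pt) (M : Finset (Pt × Pt)) (p : Pt) (T : Set Pt) : Prop :=
  IsCell P M T ∧ ∃ ε₀ > (0 : ℝ), ∀ ε : ℝ, 0 < ε → ε < ε₀ →
    ((p.1 + ε, p.2) : Pt) ∈ T

/-- `q` is the left bifurcation point of `p`: part of the boundary of the cell
to the left of `p` lies on the vertical wall of `q`, and `x(q)` is the infimum
of the abscissas of points of that cell. -/
def IsLeftBifPoint (P : Finset Pt) (M : Finset (Pt × Pt)) (p q : Pt) : Prop :=
  q ∈ P ∧ ∃ T, IsLeftCellOf P M p T ∧ (frontier T ∩ Wall M q).Nonempty ∧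
    IsGLB {x : ℝ | ∃ y : ℝ, ((x, y) : Pt) ∈ T} q.1

/-- `q` is the right bifurcation point of `p`. -/
def IsRightBifPoint (P : Finset Pt) (M : Finset (Pt × Pt)) (p q : Pt) : Prop :=
  q ∈ P ∧ ∃ T, IsRightCellOf P M p T ∧ (frontier T ∩ Wall M q).Nonempty ∧
    IsLUB {x : ℝ | ∃ y : ℝ, ((x, y) : Pt) ∈ T} q.1

/-- The edge `e` of `M` is vertically visible below `p`. -/
def EdgeVisBelow (P : Finset Pt) (M : Finset (Pt × Pt)) (e : Pt × Pt) (p : Pt) : Prop :=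
  e.1.1 < p.1 ∧ p.1 < e.2.1 ∧ yOn e p.1 < p.2 ∧
  (∀ f ∈ M, openSegment ℝ p (vproj e p) ∩ Seg f.1 f.2 = ∅) ∧
  ∀ r ∈ P, r ∉ openSegment ℝ p (vproj e p)

/-- The edge `e` of `M` is vertically visible above `p`. -/
def EdgeVisAbove (P : Finset Pt) (M : Finset (Pt × Pt)) (e : Pt × Pt) (p : Pt) : Prop :=
  e.1.1 < p.1 ∧ p.1 < e.2.1 ∧ p.2 < yOn e p.1 ∧
  (∀ f ∈ M, openSegment ℝ p (vproj e p) ∩ Seg f.1 f.2 = ∅) ∧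
  ∀ r ∈ P, r ∉ openSegment ℝ p (vproj e p)

end


/-- The bound obtained from the sweep. -/
def FF : ℕ → ℕ
  | 0 => 0
  | k + 1 => max (k + 1 + FF k) (2 * FF k)

lemma sign_const (d : ℝ → ℝ) (hd : Continuous d) (a b : ℝ) (hab : a ≤ b)
    (h0 : ∀ u, a ≤ u → u ≤ b → d u ≠ 0) : (d a < 0 ↔ d b < 0) := by
  constructor
  · intro ha
    by_contra hb
    push Not at hb
    obtain ⟨u, hu, hu0⟩ := intermediate_value_Icc hab hd.continuousOn ⟨ha.le, hb⟩
    exact h0 u hu.1 hu.2 hu0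
  · intro hb
    by_contra ha
    push Not at ha
    obtain ⟨u, hu, hu0⟩ := intermediate_value_Icc' hab hd.continuousOn ⟨hb.le, ha⟩
    exact h0 u hu.1 hu.2 hu0

/-- strictly between -/
def SBtwn (a b c : ℝ) : Prop := (a < b ∧ b < c) ∨ (c < b ∧ b < a)

open Finset in
theorem sweep {α β : Type} (P : Finset α) (X Y : α → ℝ) (N : Finset β)
    (lo hi : β → α) (h : β → ℝ → ℝ) (g : α → ℝ → ℝ) (L : Finset α) (C : α → Prop) (T0 : ℝ)
    (hX : ∀ a ∈ P, ∀ b ∈ P, X a = X b → a = b)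
    (hL : L ⊆ P) (hh : ∀ e ∈ N, Continuous (h e)) (hg : ∀ q ∈ L, Continuous (g q))
    (hhi : ∀ e ∈ N, hi e ∈ P)
    (hlh : ∀ e ∈ N, X (lo e) < X (hi e))
    (nsh : ∀ e ∈ N, ∀ f ∈ N, hi e = hi f → e = f)
    (hLe : ∀ q ∈ L, ∀ e ∈ N, q ≠ lo e ∧ q ≠ hi e)
    (ncr : ∀ q ∈ L, ∀ e ∈ N, ∀ t, X q ≤ t → t ≤ T0 → X (lo e) ≤ t → t ≤ X (hi e) →
      h e t ≠ g q t)
    (hgY : ∀ q ∈ L, g q (X q) = Y q) (hhY : ∀ e ∈ N, h e (X (hi e)) = Y (hi e))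
    (CL : ∀ q ∈ L, C q) (Chi : ∀ e ∈ N, C (hi e)) :
    ∀ n k (t : ℝ) (S : Finset α), S ⊆ L → (∀ q ∈ S, X q < t) → t ≤ T0 →
      #{r ∈ P | X r < t} = n →
      (∀ q ∈ S, ∀ q' ∈ S, ∀ e ∈ N, X (lo e) < t → t ≤ X (hi e) → h e t < g q t → h e t < g q' t) →
      ∑ q ∈ S, (k - #{r ∈ P | X q < X r ∧ X r < t ∧ C r ∧
        ∀ f ∈ N, X (lo f) ≤ X r → X r ≤ X (hi f) → ¬ SBtwn (Y r) (h f (X r)) (g q (X r))}) ≤ FF k := by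
  intro n
  induction n using Nat.strong_induction_on with
  | _ n ih =>
  intro k t S hSL hSt ht hn gap
  rcases Finset.eq_empty_or_nonempty {r ∈ P | X r < t} with hem | hne
  · have : S = ∅ := by
      rw [Finset.eq_empty_iff_forall_notMem]
      intro q hq
      have : q ∈ ({r ∈ P | X r < t} : Finset α) := by
        simp [hL (hSL hq), hSt q hq]
      rw [hem] at this
      simp at this
    simp [this]
  obtain ⟨r, hr, hrmax⟩ := Finset.exists_max_image _ X hne
  rw [mem_filter] at hr
  obtain ⟨hrP, hrt⟩ := hr
  have hmax : ∀ a ∈ P, X a < t → X a ≤ X r := fun a ha hat => hrmax a (by simp [ha, hat])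
  set R : α → ℝ → ℕ := fun q t => #{r ∈ P | X q < X r ∧ X r < t ∧ C r ∧
        ∀ f ∈ N, X (lo f) ≤ X r → X r ≤ X (hi f) → ¬ SBtwn (Y r) (h f (X r)) (g q (X r))} with hR
  change ∑ q ∈ S, (k - R q t) ≤ FF k
  have hcard : #{a ∈ P | X a < X r} < n := by
    rw [← hn]
    apply Finset.card_lt_card
    rw [Finset.ssubset_iff_of_subset]
    · exact ⟨r, by simp [hrP, hrt], by simp⟩
    · intro a; simp only [mem_filter]; rintro ⟨h1, h2⟩; exact ⟨h1, h2.trans hrt⟩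
  have IH : ∀ k (S' : Finset α), S' ⊆ S → (∀ q ∈ S', q ≠ r) →
      (∀ q ∈ S', ∀ q' ∈ S', ∀ e ∈ N, X (lo e) < X r → X r ≤ X (hi e) → h e (X r) < g q (X r) →
        h e (X r) < g q' (X r)) → ∑ q ∈ S', (k - R q (X r)) ≤ FF k := by
    intro k S' hS' hne hgap
    refine ih _ hcard k (X r) S' (hS'.trans hSL) ?_ (hrt.le.trans ht) rfl hgap
    intro q hq
    refine lt_of_le_of_ne (hmax q (hL (hSL (hS' hq))) (hSt q (hS' hq))) ?_
    intro he
    exact hne q hq (hX _ (hL (hSL (hS' hq))) _ hrP he)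
  have mono : ∀ q, R q (X r) ≤ R q t := by
    intro q
    apply Finset.card_le_card
    intro a; simp only [mem_filter]; rintro ⟨h1, h2, h3, h4⟩; exact ⟨h1, h2, h3.trans hrt, h4⟩
  have step : ∀ q, X q < X r → C r → (∀ f ∈ N, X (lo f) ≤ X r → X r ≤ X (hi f) →
      ¬ SBtwn (Y r) (h f (X r)) (g q (X r))) → R q (X r) + 1 ≤ R q t := by
    intro q h1 h2 h3
    apply Nat.succ_le_of_lt
    apply Finset.card_lt_card
    rw [Finset.ssubset_iff_of_subset]
    · exact ⟨r, by simp only [mem_filter]; exact ⟨hrP, h1, hrt, h2, h3⟩, by simp⟩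
    · intro a; simp only [mem_filter]; rintro ⟨h1, h2, h3, h4⟩; exact ⟨h1, h2, h3.trans hrt, h4⟩
  have hle : ∀ q ∈ S, X q ≤ X r := fun q hq => hmax q (hL (hSL hq)) (hSt q hq)
  have K : ∀ q ∈ S, ∀ q' ∈ S, ∀ e ∈ N, X (lo e) ≤ X r → X r < X (hi e) →
      h e (X r) < g q (X r) → h e (X r) < g q' (X r) := by
    intro q hq q' hq' e he h1 h2 h3
    have h4 : t ≤ X (hi e) := by
      by_contra hc
      push Not at hc
      exact absurd (hmax _ (hhi e he) hc) (not_le.2 h2)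
    have key : ∀ q ∈ S, (h e (X r) < g q (X r) ↔ h e t < g q t) := by
      intro q hq
      have := sign_const (fun u => h e u - g q u) ((hh e he).sub (hg q (hSL hq))) (X r) t hrt.le
        (fun u hu1 hu2 => sub_ne_zero.2 (ncr q (hSL hq) e he u ((hle q hq).trans hu1)
          (hu2.trans ht) (h1.trans hu1) (hu2.trans h4)))
      simpa [sub_neg] using this
    rw [key q' hq']
    rw [key q hq] at h3
    exact gap q hq q' hq' e he (h1.trans_lt hrt) h4 h3
  have gapOK : ∀ S' ⊆ S, (∀ e ∈ N, hi e ≠ r) → 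
      (∀ q ∈ S', ∀ q' ∈ S', ∀ e ∈ N, X (lo e) < X r → X r ≤ X (hi e) → h e (X r) < g q (X r) →
        h e (X r) < g q' (X r)) := by
    intro S' hS' hno q hq q' hq' e he h1 h2 h3
    refine K q (hS' hq) q' (hS' hq') e he h1.le (lt_of_le_of_ne h2 ?_) h3
    intro hx
    exact hno e he (hX _ (hhi e he) _ hrP hx.symm)
  by_cases hA : ∃ e0 ∈ N, hi e0 = r
  · obtain ⟨e0, he0, rfl⟩ := hA
    have hSr : ∀ q ∈ S, q ≠ hi e0 := fun q hq => (hLe q (hSL hq) e0 he0).2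
    have hSlt : ∀ q ∈ S, X q < X (hi e0) := fun q hq => lt_of_le_of_ne (hle q hq)
      (fun hx => hSr q hq (hX _ (hL (hSL hq)) _ hrP hx))
    have gapSide : ∀ S' ⊆ S, (∀ q ∈ S', ∀ q' ∈ S', Y (hi e0) < g q (X (hi e0)) →
        Y (hi e0) < g q' (X (hi e0))) → 
      (∀ q ∈ S', ∀ q' ∈ S', ∀ e ∈ N, X (lo e) < X (hi e0) → X (hi e0) ≤ X (hi e) →
        h e (X (hi e0)) < g q (X (hi e0)) → h e (X (hi e0)) < g q' (X (hi e0))) := by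
      intro S' hS' hside q hq q' hq' e he h1 h2 h3
      rcases h2.lt_or_eq with h2 | h2
      · exact K q (hS' hq) q' (hS' hq') e he h1.le h2 h3
      · have := nsh e he e0 he0 (hX _ (hhi e he) _ hrP h2.symm)
        subst this
        rw [hhY e he] at h3 ⊢
        exact hside q hq q' hq' h3
    by_cases hsplit : ∀ q ∈ S, ∀ q' ∈ S, Y (hi e0) < g q (X (hi e0)) →
        Y (hi e0) < g q' (X (hi e0))
    · refine le_trans (Finset.sum_le_sum ?_) (IH k S subset_rfl hSr (gapSide S subset_rfl hsplit))
      intro q hq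
      have := mono q
      omega
    · push Not at hsplit
      obtain ⟨q1, hq1, q2, hq2, hu, hd⟩ := hsplit
      have hne : ∀ q ∈ S, g q (X (hi e0)) ≠ Y (hi e0) := by
        intro q hq hx
        exact ncr q (hSL hq) e0 he0 _ (hle q hq) (hrt.le.trans ht) (hlh e0 he0).le le_rfl
          ((hhY e0 he0).trans hx.symm)
      have hd' := lt_of_le_of_ne hd (hne q2 hq2)
      rcases k with _ | k
      · simp [FF]
      have vis : ∀ q ∈ S, R q (X (hi e0)) + 1 ≤ R q t := by
        intro q hq
        refine step q (hSlt q hq) (Chi e0 he0) ?_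
        intro f hf h1 h2 hb
        by_cases hfe : f = e0
        · subst hfe
          rw [hhY f hf] at hb
          rcases hb with hb | hb
          · exact lt_irrefl _ hb.1
          · exact lt_irrefl _ hb.2
        have h2' : X (hi e0) < X (hi f) := lt_of_le_of_ne h2
          (fun hx => hfe (nsh f hf e0 he0 (hX _ (hhi f hf) _ hrP hx.symm)))
        rcases hb with ⟨hb1, hb2⟩ | ⟨hb1, hb2⟩
        · have := K q hq q2 hq2 f hf h1 h2' hb2
          linarith
        · have := K q1 hq1 q hq f hf h1 h2' (hb2.trans hu)
          linarith
      rw [← Finset.sum_filter_add_sum_filter_not S (fun q => Y (hi e0) < g q (X (hi e0)))]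
      have b1 := IH k (S.filter (fun q => Y (hi e0) < g q (X (hi e0)))) (filter_subset _ _)
        (fun q hq => hSr q (mem_filter.1 hq).1)
        (gapSide _ (filter_subset _ _) (fun q hq q' hq' _ => (mem_filter.1 hq').2))
      have b2 := IH k (S.filter (fun q => ¬ Y (hi e0) < g q (X (hi e0)))) (filter_subset _ _)
        (fun q hq => hSr q (mem_filter.1 hq).1)
        (gapSide _ (filter_subset _ _) (fun q hq q' hq' hx => absurd hx (mem_filter.1 hq).2))
      have c : ∀ S' ⊆ S, ∑ q ∈ S', (k + 1 - R q t) ≤ ∑ q ∈ S', (k - R q (X (hi e0))) := by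
        intro S' hS'
        refine Finset.sum_le_sum ?_
        intro q hq
        have := vis q (hS' hq)
        omega
      have c1 := c _ (filter_subset (fun q => Y (hi e0) < g q (X (hi e0))) S)
      have c2 := c _ (filter_subset (fun q => ¬ Y (hi e0) < g q (X (hi e0))) S)
      have : 2 * FF k ≤ FF (k + 1) := le_max_right _ _
      omega
  · push Not at hA
    by_cases hrS : r ∈ S
    · rcases k with _ | k
      · simp [FF]
      have b := IH k (S.erase r) (erase_subset _ _) (fun q hq => (mem_erase.1 hq).1)
        (gapOK _ (erase_subset _ _) hA)
      rw [← Finset.add_sum_erase S _ hrS]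
      have c : ∑ q ∈ S.erase r, (k + 1 - R q t) ≤ ∑ q ∈ S.erase r, (k - R q (X r)) := by
        refine Finset.sum_le_sum ?_
        intro q hq
        rw [mem_erase] at hq
        obtain ⟨hqr, hq⟩ := hq
        have hqlt : X q < X r := lt_of_le_of_ne (hle q hq)
          (fun hx => hqr (hX _ (hL (hSL hq)) _ hrP hx))
        have := step q hqlt (CL r (hSL hrS)) (by
          intro f hf h1 h2 hb
          have h2' : X r < X (hi f) := lt_of_le_of_ne h2
            (fun hx => hA f hf (hX _ (hhi f hf) _ hrP hx.symm))
          rw [← hgY r (hSL hrS)] at hb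
          rcases hb with ⟨hb1, hb2⟩ | ⟨hb1, hb2⟩
          · have := K q hq r hrS f hf h1 h2' hb2
            linarith
          · have := K r hrS q hq f hf h1 h2' hb2
            linarith)
        omega
      have : k + 1 + FF k ≤ FF (k + 1) := le_max_left _ _
      omega
    · refine le_trans (Finset.sum_le_sum ?_) (IH k S subset_rfl ?_ (gapOK S subset_rfl hA))
      · intro q hq
        have := mono q
        omega
      · rintro q hq rfl; exact hrS hq

lemma yOn_left (e : Pt × Pt) : yOn e e.1.1 = e.1.2 := by simp [yOn]

lemma yOn_right (e : Pt × Pt) (h : e.1.1 < e.2.1) : yOn e e.2.1 = e.2.2 := by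
  have : e.2.1 - e.1.1 ≠ 0 := by linarith
  unfold yOn
  field_simp
  ring

lemma yOn_cont (e : Pt × Pt) : Continuous (yOn e) := by
  unfold yOn
  fun_prop

lemma yOn_mem (e : Pt × Pt) (h : e.1.1 < e.2.1) (t : ℝ) (h1 : e.1.1 ≤ t) (h2 : t ≤ e.2.1) :
    ((t, yOn e t) : Pt) ∈ Seg e.1 e.2 := by
  have h0 : 0 < e.2.1 - e.1.1 := by linarith
  refine ⟨(e.2.1 - t) / (e.2.1 - e.1.1), (t - e.1.1) / (e.2.1 - e.1.1),
    div_nonneg (by linarith) h0.le, div_nonneg (by linarith) h0.le, ?_, ?_⟩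
  · field_simp; ring
  · ext
    · simp; field_simp; ring
    · simp [yOn]; field_simp; ring

lemma yOn_ne {P : Finset Pt} {M : Finset (Pt × Pt)} (hM : IsMatching P M) {e f : Pt × Pt}
    (he : e ∈ M) (hf : f ∈ M) (hne : e ≠ f) (t : ℝ) (h1 : e.1.1 ≤ t) (h2 : t ≤ e.2.1)
    (h3 : f.1.1 ≤ t) (h4 : t ≤ f.2.1) : yOn e t ≠ yOn f t := by
  intro h
  have a := yOn_mem e (hM.x_lt e he) t h1 h2
  have b := yOn_mem f (hM.x_lt f hf) t h3 h4
  rw [← h] at b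
  have := hM.no_cross e he f hf hne
  exact Set.eq_empty_iff_forall_notMem.1 this _ ⟨a, b⟩

lemma yOn_ne_pt {P : Finset Pt} (hP : GenPos P) {e : Pt × Pt} (h1 : e.1 ∈ P) (h2 : e.2 ∈ P)
    {r : Pt} (hr : r ∈ P) (ha : e.1.1 < r.1) (hb : r.1 < e.2.1) : yOn e r.1 ≠ r.2 := by
  intro h
  have a := yOn_mem e (ha.trans hb) r.1 ha.le hb.le
  rw [h] at a
  have hw : Wbtw ℝ e.1 r e.2 := mem_segment_iff_wbtw.1 a
  refine hP.1 e.1 h1 r hr e.2 h2 ?_ ?_ ?_ hw.collinear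
  · intro h; rw [h] at ha; exact lt_irrefl _ ha
  · intro h; rw [h] at hb; exact lt_irrefl _ hb
  · intro h; rw [h] at ha; exact lt_irrefl _ (ha.trans hb)

/-- `e` sees `r`. -/
def Sees (M : Finset (Pt × Pt)) (e : Pt × Pt) (r : Pt) : Prop :=
  e.1.1 < r.1 ∧ r.1 < e.2.1 ∧ ∀ f ∈ M, f ≠ e → f.1.1 ≤ r.1 → r.1 ≤ f.2.1 →
    ¬ SBtwn r.2 (yOn f r.1) (yOn e r.1)

def CR (M : Finset (Pt × Pt)) (r : Pt) : Prop := Isolated M r ∨ IsRightEndpoint M r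
def CLf (M : Finset (Pt × Pt)) (r : Pt) : Prop := Isolated M r ∨ IsLeftEndpoint M r

open Finset in
noncomputable def rkR (P : Finset Pt) (M : Finset (Pt × Pt)) (e : Pt × Pt) : ℕ := #{r ∈ P | CR M r ∧ Sees M e r}
open Finset in
noncomputable def rkL (P : Finset Pt) (M : Finset (Pt × Pt)) (e : Pt × Pt) : ℕ := #{r ∈ P | CLf M r ∧ Sees M e r}

lemma matching_sub {P : Finset Pt} {M N : Finset (Pt × Pt)} (hM : IsMatching P M) (h : N ⊆ M) :
    IsMatching P N :=
  ⟨fun e he => hM.left_mem e (h he), fun e he => hM.right_mem e (h he),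
   fun e he => hM.x_lt e (h he), fun e he f hf => hM.no_shared e (h he) f (h hf),
   fun e he f hf => hM.no_cross e (h he) f (h hf)⟩

lemma iso_insert {N : Finset (Pt × Pt)} {a b r : Pt} (h : Isolated N r) (ha : a.1 < r.1)
    (hb : r.1 < b.1) : Isolated (insert (a, b) N) r := by
  intro e he
  rw [Finset.mem_insert] at he
  rcases he with rfl | he
  · constructor
    · rintro rfl; exact lt_irrefl _ ha
    · rintro rfl; exact lt_irrefl _ hb
  · exact h e he

lemma genpos_x {P : Finset Pt} (hP : GenPos P) : ∀ a ∈ P, ∀ b ∈ P, a.1 = b.1 → a = b := by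
  intro a ha b hb h
  by_contra hne
  exact hP.2 a ha b hb hne h

lemma notMem_of_iso_right {N : Finset (Pt × Pt)} {p q : Pt} (h : Isolated N p) : (q, p) ∉ N :=
  fun hx => (h _ hx).2 rfl
lemma notMem_of_iso_left {N : Finset (Pt × Pt)} {p q : Pt} (h : Isolated N p) : (p, q) ∉ N :=
  fun hx => (h _ hx).1 rfl

open Finset in
lemma left_bound (P : Finset Pt) (hP : GenPos P) (N : Finset (Pt × Pt)) (hN : IsMatching P N)
    (p : Pt) (hpi : Isolated N p) :
    ∑ q ∈ P with IsMatching P (insert (q, p) N), (4 - rkR P (insert (q, p) N) (q, p)) ≤ 12 := by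
  have hnm : ∀ q, (q, p) ∉ N := fun q => notMem_of_iso_right hpi
  have hmemL : ∀ q ∈ ({q ∈ P | IsMatching P (insert (q, p) N)} : Finset Pt),
      q ∈ P ∧ IsMatching P (insert (q, p) N) := fun q hq => mem_filter.1 hq
  have hqp : ∀ q ∈ ({q ∈ P | IsMatching P (insert (q, p) N)} : Finset Pt), q.1 < p.1 :=
    fun q hq => (hmemL q hq).2.x_lt (q, p) (mem_insert_self _ _)
  have := sweep P (fun a => a.1) (fun a => a.2) N (fun e => e.1) (fun e => e.2) yOn
    (fun q => yOn (q, p)) {q ∈ P | IsMatching P (insert (q, p) N)} (CR N) p.1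
    (genpos_x hP) (filter_subset _ _) (fun e _ => yOn_cont e) (fun q _ => yOn_cont _)
    hN.right_mem hN.x_lt
    (by
      intro e he f hf h
      by_contra hne
      exact (hN.no_shared e he f hf hne).2.2.2 h)
    (by
      intro q hq e he
      have hs := (hmemL q hq).2.no_shared (q, p) (mem_insert_self _ _) e (mem_insert_of_mem he)
        (fun h => hnm q (h ▸ he))
      exact ⟨hs.1, hs.2.1⟩)
    (by
      intro q hq e he t h1 h2 h3 h4
      exact yOn_ne (hmemL q hq).2 (mem_insert_of_mem he) (mem_insert_self _ _)
        (fun h => hnm q (h ▸ he)) t h3 h4 h1 h2)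
    (fun q _ => yOn_left (q, p))
    (fun e he => yOn_right e (hN.x_lt e he))
    (by
      intro q hq
      left
      intro e he
      have hs := (hmemL q hq).2.no_shared (q, p) (mem_insert_self _ _) e (mem_insert_of_mem he)
        (fun h => hnm q (h ▸ he))
      exact ⟨hs.1.symm, hs.2.1.symm⟩)
    (fun e he => Or.inr ⟨e, he, rfl⟩)
    _ 4 p.1 {q ∈ P | IsMatching P (insert (q, p) N)} subset_rfl hqp le_rfl rfl
    (by
      intro q hq q' hq' e he h1 h2 h3
      have e1 : yOn (q, p) p.1 = p.2 := yOn_right (q, p) (hqp q hq)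
      have e2 : yOn (q', p) p.1 = p.2 := yOn_right (q', p) (hqp q' hq')
      simp only [e1, e2] at h3 ⊢
      exact h3)
  refine le_trans (Finset.sum_le_sum ?_) (this.trans (by decide))
  intro q hq
  apply Nat.sub_le_sub_left
  apply Finset.card_le_card
  intro r
  simp only [mem_filter]
  rintro ⟨h1, h2, h3, h4, h5⟩
  refine ⟨h1, ?_, h2, h3, ?_⟩
  · rcases h4 with h4 | ⟨e, he, h4⟩
    · exact Or.inl (iso_insert h4 h2 h3)
    · exact Or.inr ⟨e, mem_insert_of_mem he, h4⟩
  · intro f hf hne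
    exact h5 f (mem_of_mem_insert_of_ne hf hne)

open Finset in
lemma right_bound (P : Finset Pt) (hP : GenPos P) (N : Finset (Pt × Pt)) (hN : IsMatching P N)
    (p : Pt) (hpi : Isolated N p) :
    ∑ q ∈ P with IsMatching P (insert (p, q) N), (4 - rkL P (insert (p, q) N) (p, q)) ≤ 12 := by
  have hnm : ∀ q, (p, q) ∉ N := fun q => notMem_of_iso_left hpi
  have hmemL : ∀ q ∈ ({q ∈ P | IsMatching P (insert (p, q) N)} : Finset Pt),
      q ∈ P ∧ IsMatching P (insert (p, q) N) := fun q hq => mem_filter.1 hq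
  have hqp : ∀ q ∈ ({q ∈ P | IsMatching P (insert (p, q) N)} : Finset Pt), p.1 < q.1 :=
    fun q hq => (hmemL q hq).2.x_lt (p, q) (mem_insert_self _ _)
  have := sweep P (fun a => -a.1) (fun a => a.2) N (fun e => e.2) (fun e => e.1)
    (fun e t => yOn e (-t))
    (fun q t => yOn (p, q) (-t)) {q ∈ P | IsMatching P (insert (p, q) N)} (CLf N) (-p.1)
    (fun a ha b hb h => genpos_x hP a ha b hb (neg_injective h))
    (filter_subset _ _) (fun e _ => (yOn_cont e).comp continuous_neg)
    (fun q _ => (yOn_cont _).comp continuous_neg)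
    hN.left_mem (fun e he => neg_lt_neg (hN.x_lt e he))
    (by
      intro e he f hf h
      by_contra hne
      exact (hN.no_shared e he f hf hne).1 h)
    (by
      intro q hq e he
      have hs := (hmemL q hq).2.no_shared (p, q) (mem_insert_self _ _) e (mem_insert_of_mem he)
        (fun h => hnm q (h ▸ he))
      exact ⟨hs.2.2.2, hs.2.2.1⟩)
    (by
      intro q hq e he t h1 h2 h3 h4
      exact yOn_ne (hmemL q hq).2 (mem_insert_of_mem he) (mem_insert_self _ _)
        (fun h => hnm q (h ▸ he)) (-t) (by linarith) (by linarith)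
          (le_neg.2 h2) (neg_le.1 h1))
    (fun q hq => by
      simp only [neg_neg]
      exact yOn_right (p, q) (hqp q hq))
    (fun e he => by
      simp only [neg_neg]
      exact yOn_left e)
    (by
      intro q hq
      left
      intro e he
      have hs := (hmemL q hq).2.no_shared (p, q) (mem_insert_self _ _) e (mem_insert_of_mem he)
        (fun h => hnm q (h ▸ he))
      exact ⟨hs.2.2.1.symm, hs.2.2.2.symm⟩)
    (fun e he => Or.inr ⟨e, he, rfl⟩)
    _ 4 (-p.1) {q ∈ P | IsMatching P (insert (p, q) N)} subset_rfl
    (fun q hq => neg_lt_neg (hqp q hq)) le_rfl rfl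
    (by
      intro q hq q' hq' e he h1 h2 h3
      have e1 : yOn (p, q) p.1 = p.2 := yOn_left (p, q)
      have e2 : yOn (p, q') p.1 = p.2 := yOn_left (p, q')
      simp only [neg_neg, e1, e2] at h3 ⊢
      exact h3)
  refine le_trans (Finset.sum_le_sum ?_) (this.trans (by decide))
  intro q hq
  apply Nat.sub_le_sub_left
  apply Finset.card_le_card
  intro r
  simp only [mem_filter, neg_neg, neg_lt_neg_iff, neg_le_neg_iff]
  rintro ⟨h1, h2, h3, h4, h5⟩
  refine ⟨h1, ?_, h3, h2, ?_⟩
  · rcases h4 with h4 | ⟨e, he, h4⟩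
    · exact Or.inl (iso_insert h4 h3 h2)
    · exact Or.inr ⟨e, mem_insert_of_mem he, h4⟩
  · intro f hf hne ha hb
    exact h5 f (mem_of_mem_insert_of_ne hf hne) hb ha

open Finset in
lemma sees_two (P : Finset Pt) (hP : GenPos P) (M : Finset (Pt × Pt)) (hM : IsMatching P M)
    (r : Pt) (hr : r ∈ P) : #{e ∈ M | Sees M e r} ≤ 2 := by
  rw [show 2 = #(Finset.univ : Finset Bool) from rfl]
  apply Finset.card_le_card_of_injOn (fun e => decide (yOn e r.1 < r.2)) (fun _ _ => Finset.mem_coe.2 (Finset.mem_univ _))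
  intro e he f hf hef
  rw [mem_coe, mem_filter] at he hf
  obtain ⟨he, h1, h2, h3⟩ := he
  obtain ⟨hf, k1, k2, k3⟩ := hf
  by_contra hne
  have a := yOn_ne_pt hP (hM.left_mem e he) (hM.right_mem e he) hr h1 h2
  have b := yOn_ne_pt hP (hM.left_mem f hf) (hM.right_mem f hf) hr k1 k2
  have c := yOn_ne hM he hf hne r.1 h1.le h2.le k1.le k2.le
  have u := h3 f hf (Ne.symm hne) k1.le k2.le
  have v := k3 e he hne h1.le h2.le
  have hef' : (yOn e r.1 < r.2 ↔ yOn f r.1 < r.2) := by simpa using hef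
  unfold SBtwn at u v
  by_cases hlt : yOn e r.1 < r.2
  · have hlt' := hef'.1 hlt
    rcases lt_or_gt_of_ne c with c | c
    · exact u (Or.inr ⟨c, hlt'⟩)
    · exact v (Or.inr ⟨c, hlt⟩)
  · have hgt : r.2 < yOn e r.1 := lt_of_le_of_ne (not_lt.1 hlt) a.symm
    have hgt' : r.2 < yOn f r.1 := lt_of_le_of_ne (not_lt.1 (fun h => hlt (hef'.2 h))) b.symm
    rcases lt_or_gt_of_ne c with c | c
    · exact v (Or.inl ⟨hgt, c⟩)
    · exact u (Or.inl ⟨hgt', c⟩)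

open Finset in
lemma sum_rk (P : Finset Pt) (hP : GenPos P) (M : Finset (Pt × Pt)) (hM : IsMatching P M)
    (C : Pt → Prop) : ∑ e ∈ M, #{r ∈ P | C r ∧ Sees M e r} ≤ 2 * #{r ∈ P | C r} := by
  have h1 : ∀ e ∈ M, #{r ∈ P | C r ∧ Sees M e r} =
      #(Finset.bipartiteAbove (fun e r => Sees M e r) {r ∈ P | C r} e) := by
    intro e _
    rw [Finset.bipartiteAbove, Finset.filter_filter]
  rw [Finset.sum_congr rfl h1, Finset.sum_card_bipartiteAbove_eq_sum_card_bipartiteBelow]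
  rw [mul_comm, ← smul_eq_mul]
  apply Finset.sum_le_card_nsmul
  intro r hr
  exact sees_two P hP M hM r (mem_filter.1 hr).1

lemma inj_fst {P : Finset Pt} {M : Finset (Pt × Pt)} (hM : IsMatching P M) :
    Set.InjOn (Prod.fst : Pt × Pt → Pt) M := by
  intro e he f hf h
  by_contra hne
  exact (hM.no_shared e he f hf hne).1 h

lemma inj_snd {P : Finset Pt} {M : Finset (Pt × Pt)} (hM : IsMatching P M) :
    Set.InjOn (Prod.snd : Pt × Pt → Pt) M := by
  intro e he f hf h
  by_contra hne
  exact (hM.no_shared e he f hf hne).2.2.2 h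

lemma lr_ne {P : Finset Pt} {M : Finset (Pt × Pt)} (hM : IsMatching P M) {e f : Pt × Pt}
    (he : e ∈ M) (hf : f ∈ M) : e.1 ≠ f.2 := by
  intro h
  by_cases hef : e = f
  · subst hef
    have := hM.x_lt e he
    rw [h] at this
    exact lt_irrefl _ this
  · exact (hM.no_shared e he f hf hef).2.1 h

open Finset in
lemma card_CR {P : Finset Pt} {M : Finset (Pt × Pt)} (hM : IsMatching P M) :
    #{r ∈ P | CR M r} + #M = #P := by
  rw [← Finset.card_filter_add_card_filter_not (s := P) (CR M)]
  congr 1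
  rw [← Finset.card_image_of_injOn (inj_fst hM)]
  congr 1
  ext r
  simp only [mem_image, mem_filter]
  simp only [CR, Isolated, IsRightEndpoint]
  constructor
  · rintro ⟨e, he, rfl⟩
    refine ⟨hM.left_mem e he, ?_⟩
    rintro (h | ⟨f, hf, h⟩)
    · exact (h e he).1 rfl
    · exact lr_ne hM he hf h.symm
  · rintro ⟨hr, h⟩
    push Not at h
    obtain ⟨⟨e, he, h1⟩, h2⟩ := h
    refine ⟨e, he, ?_⟩
    by_contra h3
    exact h2 e he (h1 h3)

open Finset in
lemma card_CLf {P : Finset Pt} {M : Finset (Pt × Pt)} (hM : IsMatching P M) :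
    #{r ∈ P | CLf M r} + #M = #P := by
  rw [← Finset.card_filter_add_card_filter_not (s := P) (CLf M)]
  congr 1
  rw [← Finset.card_image_of_injOn (inj_snd hM)]
  congr 1
  ext r
  simp only [mem_image, mem_filter]
  simp only [CLf, Isolated, IsLeftEndpoint]
  constructor
  · rintro ⟨e, he, rfl⟩
    refine ⟨hM.right_mem e he, ?_⟩
    rintro (h | ⟨f, hf, h⟩)
    · exact (h e he).2 rfl
    · exact lr_ne hM hf he h
  · rintro ⟨hr, h⟩
    push Not at h
    obtain ⟨⟨e, he, h1⟩, h2⟩ := h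
    exact ⟨e, he, h1 (h2 e he)⟩

open Finset in
lemma card_iso {P : Finset Pt} {M : Finset (Pt × Pt)} (hM : IsMatching P M) :
    #{r ∈ P | Isolated M r} + 2 * #M = #P := by
  rw [← card_CR hM]
  have : ({r ∈ P | CR M r} : Finset Pt) = {r ∈ P | Isolated M r} ∪ M.image Prod.snd := by
    ext r
    simp only [mem_union, mem_image, mem_filter]
    simp only [CR, IsRightEndpoint]
    constructor
    · rintro ⟨h, h1 | h1⟩
      · exact Or.inl ⟨h, h1⟩
      · exact Or.inr h1
    · rintro (h | ⟨e, he, rfl⟩)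
      · exact ⟨h.1, Or.inl h.2⟩
      · exact ⟨hM.right_mem e he, Or.inr ⟨e, he, rfl⟩⟩
  rw [this, Finset.card_union_of_disjoint, Finset.card_image_of_injOn (inj_snd hM)]
  · omega
  · rw [Finset.disjoint_left]
    intro r hr hr'
    rw [mem_image] at hr'
    obtain ⟨e, he, rfl⟩ := hr'
    exact ((mem_filter.1 hr).2 e he).2 rfl

open Finset in
lemma per_matching {P : Finset Pt} (hP : GenPos P) {M : Finset (Pt × Pt)} (hM : IsMatching P M) :
    2 * (#P : ℤ) - 6 * ((#P : ℤ) - 2 * #M) ≤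
      ((∑ e ∈ M, ((4 - rkR P M e) + (4 - rkL P M e)) : ℕ) : ℤ) := by
  have h1 : ∑ e ∈ M, rkR P M e ≤ _ := sum_rk P hP M hM (CR M)
  have h2 : ∑ e ∈ M, rkL P M e ≤ _ := sum_rk P hP M hM (CLf M)
  have h3 := card_CR hM
  have h4 := card_CLf hM
  have h5 : 8 * #M ≤ ∑ e ∈ M, ((4 - rkR P M e) + (4 - rkL P M e)) + ∑ e ∈ M, rkR P M e +
      ∑ e ∈ M, rkL P M e := by
    rw [← Finset.sum_add_distrib, ← Finset.sum_add_distrib, mul_comm, ← smul_eq_mul]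
    apply Finset.card_nsmul_le_sum
    intro e _
    omega
  omega

open Finset in
lemma per_sub {P : Finset Pt} (hP : GenPos P) {N : Finset (Pt × Pt)} (hN : IsMatching P N) :
    ∑ x ∈ P ×ˢ P with x ∉ N ∧ IsMatching P (insert x N),
      ((4 - rkR P (insert x N) x) + (4 - rkL P (insert x N) x)) ≤ 24 * #{r ∈ P | Isolated N r} := by
  have hiso : ∀ x, x ∉ N → IsMatching P (insert x N) → Isolated N x.1 ∧ Isolated N x.2 := by
    intro x hx hm
    have : ∀ e ∈ N, _ := fun e he => hm.no_shared x (mem_insert_self _ _) e (mem_insert_of_mem he)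
        (fun h => hx (h ▸ he))
    exact ⟨fun e he => ⟨(this e he).1.symm, (this e he).2.1.symm⟩,
      fun e he => ⟨(this e he).2.2.1.symm, (this e he).2.2.2.symm⟩⟩
  rw [Finset.sum_add_distrib]
  rw [Finset.sum_finset_product_right _ {r ∈ P | Isolated N r}
    (fun p => {q ∈ P | IsMatching P (insert (q, p) N)})]
  · rw [Finset.sum_finset_product (r := {x ∈ P ×ˢ P | x ∉ N ∧ IsMatching P (insert x N)})
      {r ∈ P | Isolated N r} (fun p => {q ∈ P | IsMatching P (insert (p, q) N)})]
    · rw [← Finset.sum_add_distrib, mul_comm, ← smul_eq_mul]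
      apply Finset.sum_le_card_nsmul
      intro p hp
      rw [mem_filter] at hp
      have := left_bound P hP N hN p hp.2
      have := right_bound P hP N hN p hp.2
      omega
    · rintro ⟨a, b⟩
      simp only [mem_filter, mem_product]
      constructor
      · rintro ⟨⟨h1, h2⟩, h3, h4⟩
        exact ⟨⟨h1, (hiso _ h3 h4).1⟩, h2, h4⟩
      · rintro ⟨⟨h1, h3⟩, h2, h4⟩
        exact ⟨⟨h1, h2⟩, notMem_of_iso_left h3, h4⟩
  · rintro ⟨a, b⟩
    simp only [mem_filter, mem_product]
    constructor
    · rintro ⟨⟨h1, h2⟩, h3, h4⟩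
      exact ⟨⟨h2, (hiso _ h3 h4).2⟩, h1, h4⟩
    · rintro ⟨⟨h1, h3⟩, h2, h4⟩
      exact ⟨⟨h2, h1⟩, notMem_of_iso_right h3, h4⟩

open Finset in
lemma double_count (P : Finset Pt) (m : ℕ) (hm : 1 ≤ m) (G : Finset (Pt × Pt) → Pt × Pt → ℕ) :
    ∑ M ∈ Matchings P m, ∑ e ∈ M, G M e =
    ∑ N ∈ Matchings P (m - 1), ∑ x ∈ P ×ˢ P with x ∉ N ∧ IsMatching P (insert x N),
      G (insert x N) x := by
  rw [Finset.sum_sigma', Finset.sum_sigma']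
  refine Finset.sum_nbij' (fun a => ⟨a.1.erase a.2, a.2⟩) (fun a => ⟨insert a.2 a.1, a.2⟩) ?_ ?_ ?_ ?_ ?_
  · rintro ⟨M, e⟩ h
    simp only [mem_sigma, Matchings, mem_filter, mem_powerset] at h ⊢
    obtain ⟨⟨h1, h2, h3⟩, h4⟩ := h
    refine ⟨⟨(erase_subset _ _).trans h1, matching_sub h2 (erase_subset _ _), ?_⟩, h1 h4,
      notMem_erase _ _, ?_⟩
    · rw [card_erase_of_mem h4, h3]
    · rwa [insert_erase h4]
  · rintro ⟨N, x⟩ h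
    simp only [mem_sigma, Matchings, mem_filter, mem_powerset] at h ⊢
    obtain ⟨⟨h1, h2, h3⟩, h4, h5, h6⟩ := h
    refine ⟨⟨insert_subset h4 h1, h6, ?_⟩, mem_insert_self _ _⟩
    rw [card_insert_of_notMem h5, h3]
    omega
  · rintro ⟨M, e⟩ h
    simp only [mem_sigma] at h
    simp [insert_erase h.2]
  · rintro ⟨N, x⟩ h
    simp only [mem_sigma, mem_filter] at h
    simp [erase_insert h.2.2.1]
  · rintro ⟨M, e⟩ h
    simp only [mem_sigma] at h
    simp [insert_erase h.2]

/-- For every integer `m ≥ 1`, writing `s = n − 2m`,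
one has `(2n − 6s)·Ma_m(P) ≤ 24·(s + 2)·Ma_{m−1}(P)`. -/
theorem Ma_recurrence_four (P : Finset Pt) (hP : GenPos P) (m : ℕ) (hm : 1 ≤ m) :
    (2 * (P.card : ℤ) - 6 * ((P.card : ℤ) - 2 * m)) * Ma P m ≤
      24 * (((P.card : ℤ) - 2 * m) + 2) * Ma P (m - 1) := by
  have hmem : ∀ k, ∀ M ∈ Matchings P k, IsMatching P M ∧ M.card = k :=
    fun k M hM => (Finset.mem_filter.1 hM).2
  have hdc := double_count P m hm (fun M e => (4 - rkR P M e) + (4 - rkL P M e))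
  have h1 : (Matchings P m).card • (2 * (P.card : ℤ) - 6 * ((P.card : ℤ) - 2 * m)) ≤
      ∑ M ∈ Matchings P m, ((∑ e ∈ M, ((4 - rkR P M e) + (4 - rkL P M e)) : ℕ) : ℤ) := by
    apply Finset.card_nsmul_le_sum
    intro M hM
    have := per_matching hP (hmem m M hM).1
    rwa [(hmem m M hM).2] at this
  have h2 : ∑ N ∈ Matchings P (m - 1),
      ((∑ x ∈ P ×ˢ P with x ∉ N ∧ IsMatching P (insert x N),
        ((4 - rkR P (insert x N) x) + (4 - rkL P (insert x N) x)) : ℕ) : ℤ) ≤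
      (Matchings P (m - 1)).card • (24 * (((P.card : ℤ) - 2 * m) + 2)) := by
    apply Finset.sum_le_card_nsmul
    intro N hN
    have a := per_sub hP (hmem _ N hN).1
    have b := card_iso (hmem _ N hN).1
    rw [(hmem _ N hN).2] at b
    omega
  have h3 := h1.trans (le_of_eq_of_le (by exact_mod_cast hdc) h2)
  simp only [nsmul_eq_mul] at h3
  unfold Ma
  linarith
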